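/- Inverse expansion identity for Mittag-Leffler functions: let N be a positive integer, ζ ∈ ℂ a primitive N-th root of unity, and m an integer with 0 ≤ m < N. Then for every real α > 0, every β ∈ ℝ, and every z ∈ ℂ, (1/N) ∑_{k=0}^{N−1} ζ^{−km} E_{α,β}(ζ^k z) = z^m E_{Nα, β+αm}(z^N). -/

import Mathlib

open MeasureTheory

/-- Two-parameter Mittag-Leffler function, using the entire reciprocal Gamma
function (Mathlib's `Complex.Gamma` vanishes at nonpositive integers, so its
inverse is the entire reciprocal Gamma). -/
noncomputable def mlE (α β : ℝ) (z : ℂ) : ℂ :=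
  ∑' n : ℕ, z ^ n * (Complex.Gamma ((α * n + β : ℝ) : ℂ))⁻¹

/-- The `P` function: `P_{α,w}(λ,t) = t^w E_{α,w+1}(λ t^α)`. -/
noncomputable def Pfun (α w : ℝ) (lam : ℂ) (t : ℝ) : ℂ :=
  ((t ^ w : ℝ) : ℂ) * mlE α (w + 1) (lam * ((t ^ α : ℝ) : ℂ))

/-- The `R` (Lorenzo–Hartley) function: `R_{α,v}(λ,t) = t^{α-v-1} E_{α,α-v}(λ t^α)`. -/
noncomputable def Rfun (α v : ℝ) (lam : ℂ) (t : ℝ) : ℂ :=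
  ((t ^ (α - v - 1) : ℝ) : ℂ) * mlE α (α - v) (lam * ((t ^ α : ℝ) : ℂ))

/-- A lower bound for the real Gamma function, faster than any prescribed exponential. -/
theorem rpow_mul_exp_neg_le_Gamma {R x : ℝ} (hR : 0 < R) (hx : 1 ≤ x) :
    R ^ (x - 1) * Real.exp (-R) ≤ Real.Gamma x := by
  have hint := Real.GammaIntegral_convergent (s := x) (by linarith)
  have hsub : Set.Ioi R ⊆ Set.Ioi (0 : ℝ) := Set.Ioi_subset_Ioi hR.le
  rw [Real.Gamma_eq_integral (by linarith)]
  calc R ^ (x - 1) * Real.exp (-R)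
      = ∫ t in Set.Ioi R, Real.exp (-t) * R ^ (x - 1) := by
        rw [integral_mul_const, integral_exp_neg_Ioi, mul_comm]
    _ ≤ ∫ t in Set.Ioi R, Real.exp (-t) * t ^ (x - 1) := by
        refine setIntegral_mono_on ((integrableOn_exp_neg_Ioi R).mul_const _)
          (hint.mono_set hsub) measurableSet_Ioi fun t ht => ?_
        have : R ≤ t := le_of_lt ht
        gcongr
    _ ≤ ∫ t in Set.Ioi 0, Real.exp (-t) * t ^ (x - 1) := by
        refine setIntegral_mono_set hint ?_ hsub.eventuallyLE
        filter_upwards [ae_restrict_mem measurableSet_Ioi] with t ht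
        have : 0 < t := ht
        simp only [Pi.zero_apply]
        positivity

/-- The Mittag-Leffler series converges everywhere. -/
theorem summable_mlE (α β : ℝ) (hα : 0 < α) (z : ℂ) :
    Summable fun n : ℕ => z ^ n * (Complex.Gamma ((α * n + β : ℝ) : ℂ))⁻¹ := by
  set R : ℝ := (‖z‖ + 1) ^ α⁻¹ with hRdef
  have hz : 0 < ‖z‖ + 1 := by positivity
  have hR : 0 < R := Real.rpow_pos_of_pos hz _
  have hRα : R ^ α = ‖z‖ + 1 := by
    rw [hRdef, ← Real.rpow_mul hz.le, inv_mul_cancel₀ hα.ne', Real.rpow_one]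
  have hgeom : Summable fun n : ℕ =>
      (‖z‖ / (‖z‖ + 1)) ^ n * (R ^ (β - 1) * Real.exp (-R))⁻¹ := by
    refine (summable_geometric_of_lt_one (by positivity) ?_).mul_right _
    rw [div_lt_one hz]
    linarith
  refine hgeom.of_norm_bounded_eventually_nat ?_
  have hlim : Filter.Tendsto (fun n : ℕ => α * (n : ℝ) + β) Filter.atTop Filter.atTop :=
    Filter.tendsto_atTop_add_const_right _ _
      (tendsto_natCast_atTop_atTop.const_mul_atTop hα)
  filter_upwards [hlim.eventually_ge_atTop 1] with n hn
  have hlow := rpow_mul_exp_neg_le_Gamma hR hn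
  have hpow : R ^ (α * n + β - 1) = (‖z‖ + 1) ^ n * R ^ (β - 1) := by
    rw [add_sub_assoc, Real.rpow_add hR, Real.rpow_mul hR.le, hRα, Real.rpow_natCast]
  have hΓ : 0 < Real.Gamma (α * n + β) := Real.Gamma_pos_of_pos (by linarith)
  rw [Complex.Gamma_ofReal, norm_mul, norm_pow, norm_inv, Complex.norm_real,
    Real.norm_of_nonneg hΓ.le]
  calc ‖z‖ ^ n * (Real.Gamma (α * n + β))⁻¹
      ≤ ‖z‖ ^ n * (R ^ (α * n + β - 1) * Real.exp (-R))⁻¹ := by gcongr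
    _ = (‖z‖ / (‖z‖ + 1)) ^ n * (R ^ (β - 1) * Real.exp (-R))⁻¹ := by
        rw [hpow, div_pow, div_eq_mul_inv, mul_assoc, mul_inv, mul_inv, mul_assoc]

/-- Orthogonality of the characters of `ℤ/N`. -/
theorem IsPrimitiveRoot.sum_zpow_neg_mul_pow {N : ℕ} {ζ : ℂ} (h : IsPrimitiveRoot ζ N)
    (hN : 0 < N) (m n : ℕ) :
    ∑ k ∈ Finset.range N, ζ ^ (-((k * m : ℕ) : ℤ)) * (ζ ^ k) ^ n =
      if n ≡ m [MOD N] then (N : ℂ) else 0 := by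
  have hζ0 : ζ ≠ 0 := h.ne_zero hN.ne'
  have hpow_mod : ∀ l : ℕ, ζ ^ (l % N) = ζ ^ l := fun l => by
    rw [h.eq_orderOf, pow_mod_orderOf]
  have hterm : ∀ k : ℕ, ζ ^ (-((k * m : ℕ) : ℤ)) * (ζ ^ k) ^ n = (ζ ^ n / ζ ^ m) ^ k := by
    intro k
    rw [zpow_neg, zpow_natCast, div_pow, ← pow_mul, ← pow_mul, ← pow_mul, mul_comm k m,
      mul_comm k n, div_eq_mul_inv, mul_comm]
  simp only [hterm]
  split_ifs with hmod
  · have : ζ ^ n = ζ ^ m := by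
      rw [← hpow_mod n, ← hpow_mod m, show n % N = m % N from hmod]
    simp [this, div_self (pow_ne_zero m hζ0)]
  · have hne : ζ ^ n / ζ ^ m ≠ 1 := by
      rw [Ne, div_eq_one_iff_eq (pow_ne_zero m hζ0), ← hpow_mod n, ← hpow_mod m]
      exact fun heq => hmod (h.pow_inj (Nat.mod_lt n hN) (Nat.mod_lt m hN) heq)
    rw [geom_sum_eq hne, div_pow, ← pow_mul, ← pow_mul, mul_comm n, mul_comm m, pow_mul, pow_mul,
      h.pow_eq_one]
    simp

/-- Inverse expansion identity for Mittag-Leffler functions: if `ζ` is a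
primitive `N`-th root of unity and `0 ≤ m < N`, then
`(1/N) ∑_{k=0}^{N-1} ζ^(-km) E_{α,β}(ζ^k z) = z^m E_{Nα, β+αm}(z^N)`. -/
theorem mlE_inverse_expansion (N : ℕ) (hN : 0 < N) (ζ : ℂ) (hζ : ζ ^ N = 1)
    (hprim : ∀ k : ℕ, 0 < k → k < N → ζ ^ k ≠ 1) (m : ℕ) (hm : m < N)
    (α β : ℝ) (hα : 0 < α) (z : ℂ) :
    (1 / (N : ℂ)) * ∑ k ∈ Finset.range N, ζ ^ (-((k * m : ℕ) : ℤ)) * mlE α β (ζ ^ k * z) =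
      z ^ m * mlE ((N : ℝ) * α) (β + α * (m : ℝ)) (z ^ N) := by
  have h : IsPrimitiveRoot ζ N := IsPrimitiveRoot.mk_of_lt ζ hN hζ hprim
  have hN0 : (N : ℂ) ≠ 0 := Nat.cast_ne_zero.mpr hN.ne'
  have hcoeff : ∀ n : ℕ, (1 / (N : ℂ)) * ∑ k ∈ Finset.range N, ζ ^ (-((k * m : ℕ) : ℤ)) *
      ((ζ ^ k * z) ^ n * (Complex.Gamma ((α * n + β : ℝ) : ℂ))⁻¹) =
      if n ≡ m [MOD N] then z ^ n * (Complex.Gamma ((α * n + β : ℝ) : ℂ))⁻¹ else 0 := by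
    intro n
    simp only [mul_pow, mul_assoc]
    simp only [← mul_assoc (ζ ^ (-((_ : ℕ) : ℤ)))]
    rw [← Finset.sum_mul, h.sum_zpow_neg_mul_pow hN]
    split_ifs
    · rw [← mul_assoc, one_div_mul_cancel hN0, one_mul]
    · simp
  have hinj : Function.Injective fun j : ℕ => m + N * j := fun a b hab =>
    Nat.eq_of_mul_eq_mul_left hN (Nat.add_left_cancel hab)
  simp only [mlE, ← tsum_mul_left]
  rw [← Summable.tsum_finsetSum fun k _ => (summable_mlE α β hα (ζ ^ k * z)).mul_left _,
    ← tsum_mul_left]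
  simp only [hcoeff]
  rw [← hinj.tsum_eq]
  · refine tsum_congr fun j => ?_
    have hj : m + N * j ≡ m [MOD N] := by simp [Nat.ModEq]
    have harg : α * ((m + N * j : ℕ) : ℝ) + β = (N : ℝ) * α * j + (β + α * m) := by
      push_cast
      ring
    rw [if_pos hj, harg, pow_add, pow_mul, mul_assoc]
  · intro n hn
    have hmod : n ≡ m [MOD N] := by
      by_contra hnot
      exact hn (if_neg hnot)
    refine ⟨n / N, ?_⟩
    have hnm : n % N = m := Eq.trans hmod (Nat.mod_eq_of_lt hm)
    have := Nat.mod_add_div n N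
    rwa [hnm] at this
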